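/- Let M, N be positive integers with max{M, N} ≥ 2, let α⁰, γ⁰, μ⁰ be real numbers, and let e₁,…,e_N and f₁,…,f_M be real numbers. Let Λ be the (N+M)-dimensional vector with n-th entry α⁰ + nμ⁰ + e_n (n = 1,…,N) and (N+m)-th entry γ⁰ + mμ⁰ + f_m (m = 1,…,M), and let (α̂, γ̂, μ̂)ᵀ = (Γᵀ Γ)⁻¹ Γᵀ Λ. Then, with D = (MN/12)(N(N²−1) + M(M²−1)), the exact error representations hold: α̂ − α⁰ = [ (M/12)(2N(N+1)(2N+1) + M(M²−1))·Σₙ e_n + (MN(M+1)(N+1)/4)·Σₘ f_m − (MN(N+1)/2)·(Σₙ n e_n + Σₘ m f_m) ] / D, and μ̂ − μ⁰ = [ −(MN(N+1)/2)·Σₙ e_n − (NM(M+1)/2)·Σₘ f_m + MN·(Σₙ n e_n + Σₘ m f_m) ] / D. -/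

import Mathlib

open Matrix

/-- The design matrix `Γ_{M,N}` of Step 1 of the proposed estimation method:
its `n`-th row is `(1, 0, n)` for `n = 1,…,N` and its `(N+m)`-th row is `(0, 1, m)`
for `m = 1,…,M`. -/
noncomputable def Gamma (M N : ℕ) : Matrix (Fin (N + M)) (Fin 3) ℝ :=
  fun i j =>
    if (i : ℕ) < N then
      if j = 0 then 1 else if j = 1 then 0 else (((i : ℕ) + 1 : ℕ) : ℝ)
    else
      if j = 0 then 0 else if j = 1 then 1 else (((i : ℕ) - N + 1 : ℕ) : ℝ)


lemma sum_split_aux (M N : ℕ) (F G : ℕ → ℝ) :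
    ∑ i : Fin (N + M), (if (i : ℕ) < N then F ((i : ℕ) + 1) else G ((i : ℕ) - N + 1))
      = ∑ n ∈ Finset.Icc 1 N, F n + ∑ m ∈ Finset.Icc 1 M, G m := by
  have h : ∀ (K : ℕ) (H : ℕ → ℝ), ∑ n ∈ Finset.Icc 1 K, H n = ∑ i : Fin K, H ((i : ℕ) + 1) := by
    intro K H
    rw [Fin.sum_univ_eq_sum_range (fun i => H (i + 1)) K, Finset.range_eq_Ico,
      Finset.sum_Ico_add' H 0 K 1]
    rfl
  rw [Fin.sum_univ_add, h, h]
  simp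

lemma sum_id_aux (K : ℕ) : ∑ n ∈ Finset.Icc 1 K, (n : ℝ) = (K : ℝ) * (K + 1) / 2 := by
  induction K with
  | zero => simp
  | succ k ih => rw [Finset.sum_Icc_succ_top (by omega), ih]; push_cast; ring

lemma sum_sq_aux (K : ℕ) :
    ∑ n ∈ Finset.Icc 1 K, (n : ℝ) * n = (K : ℝ) * (K + 1) * (2 * K + 1) / 6 := by
  induction K with
  | zero => simp
  | succ k ih => rw [Finset.sum_Icc_succ_top (by omega), ih]; push_cast; ring

lemma gamma_mulVec_aux (M N : ℕ) (F G : ℕ → ℝ) (v : Fin (N + M) → ℝ)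
    (hv : ∀ i : Fin (N + M), v i =
      if (i : ℕ) < N then F ((i : ℕ) + 1) else G ((i : ℕ) - N + 1)) :
    (∑ i, Gamma M N i 0 * v i = ∑ n ∈ Finset.Icc 1 N, F n) ∧
    (∑ i, Gamma M N i 1 * v i = ∑ m ∈ Finset.Icc 1 M, G m) ∧
    (∑ i, Gamma M N i 2 * v i =
      ∑ n ∈ Finset.Icc 1 N, (n : ℝ) * F n + ∑ m ∈ Finset.Icc 1 M, (m : ℝ) * G m) := by
  refine ⟨?_, ?_, ?_⟩
  · have := sum_split_aux M N F (fun _ => 0)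
    simp only [Finset.sum_const_zero, add_zero] at this
    rw [← this]
    refine Finset.sum_congr rfl fun i _ => ?_
    rw [hv]; unfold Gamma; split_ifs <;> simp_all
  · have := sum_split_aux M N (fun _ => 0) G
    simp only [Finset.sum_const_zero, zero_add] at this
    rw [← this]
    refine Finset.sum_congr rfl fun i _ => ?_
    rw [hv]; unfold Gamma; split_ifs <;> simp_all
  · rw [← sum_split_aux M N (fun n => (n : ℝ) * F n) (fun n => (n : ℝ) * G n)]
    refine Finset.sum_congr rfl fun i _ => ?_
    rw [hv]; unfold Gamma; split_ifs <;> simp_all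

lemma gamma_gram_aux (M N : ℕ) : (Gamma M N)ᵀ * Gamma M N =
    !![(N : ℝ), 0, (N : ℝ) * (N + 1) / 2;
       0, (M : ℝ), (M : ℝ) * (M + 1) / 2;
       (N : ℝ) * (N + 1) / 2, (M : ℝ) * (M + 1) / 2,
        (N : ℝ) * (N + 1) * (2 * N + 1) / 6 + (M : ℝ) * (M + 1) * (2 * M + 1) / 6] := by
  obtain ⟨a0, a1, a2⟩ := gamma_mulVec_aux M N (fun _ => 1) (fun _ => 0) (fun i => Gamma M N i 0)
    (fun i => by simp [Gamma])
  obtain ⟨b0, b1, b2⟩ := gamma_mulVec_aux M N (fun _ => 0) (fun _ => 1) (fun i => Gamma M N i 1)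
    (fun i => by simp [Gamma])
  obtain ⟨c0, c1, c2⟩ := gamma_mulVec_aux M N (fun n => (n : ℝ)) (fun n => (n : ℝ))
    (fun i => Gamma M N i 2) (fun i => by simp [Gamma])
  simp only [sum_sq_aux, sum_id_aux, mul_one, mul_zero, Finset.sum_const_zero, add_zero,
    zero_add, Finset.sum_const, Nat.card_Icc, Nat.add_sub_cancel, nsmul_eq_mul] at *
  ext j k
  fin_cases j <;> fin_cases k <;> simp [Matrix.mul_apply, *]

/-- exact error representations for the Step-1 estimators `α̂` and `μ̂`
in terms of the column-wise errors `eₙ` and row-wise errors `fₘ`, with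
`D = (MN/12)(N(N²−1) + M(M²−1))`. -/
theorem gamma_step1_exact_error (M N : ℕ) (hM : 0 < M) (hN : 0 < N) (h2 : 2 ≤ max M N)
    (α γ μ : ℝ) (e f : ℕ → ℝ) (Λ : Fin (N + M) → ℝ)
    (hΛ : ∀ i : Fin (N + M), Λ i =
      if (i : ℕ) < N then α + ((((i : ℕ) + 1 : ℕ) : ℝ)) * μ + e ((i : ℕ) + 1)
      else γ + ((((i : ℕ) - N + 1 : ℕ) : ℝ)) * μ + f ((i : ℕ) - N + 1))
    (est : Fin 3 → ℝ)
    (hest : est = ((Gamma M N)ᵀ * Gamma M N)⁻¹ *ᵥ ((Gamma M N)ᵀ *ᵥ Λ))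
    (D : ℝ)
    (hD : D = (M : ℝ) * N / 12 * ((N : ℝ) * ((N : ℝ) ^ 2 - 1) + (M : ℝ) * ((M : ℝ) ^ 2 - 1))) :
    est 0 - α =
      ((M : ℝ) / 12 * (2 * (N : ℝ) * ((N : ℝ) + 1) * (2 * (N : ℝ) + 1) +
            (M : ℝ) * ((M : ℝ) ^ 2 - 1)) * (∑ n ∈ Finset.Icc 1 N, e n)
        + (M : ℝ) * N * ((M : ℝ) + 1) * ((N : ℝ) + 1) / 4 * (∑ m ∈ Finset.Icc 1 M, f m)
        - (M : ℝ) * N * ((N : ℝ) + 1) / 2 *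
            (∑ n ∈ Finset.Icc 1 N, (n : ℝ) * e n + ∑ m ∈ Finset.Icc 1 M, (m : ℝ) * f m)) / D
    ∧ est 2 - μ =
      (-((M : ℝ) * N * ((N : ℝ) + 1) / 2) * (∑ n ∈ Finset.Icc 1 N, e n)
        - (N : ℝ) * M * ((M : ℝ) + 1) / 2 * (∑ m ∈ Finset.Icc 1 M, f m)
        + (M : ℝ) * N *
            (∑ n ∈ Finset.Icc 1 N, (n : ℝ) * e n + ∑ m ∈ Finset.Icc 1 M, (m : ℝ) * f m)) / D := by
  have hDpos : 0 < D := by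
    have hM1 : (1 : ℝ) ≤ M := by exact_mod_cast hM
    have hN1 : (1 : ℝ) ≤ N := by exact_mod_cast hN
    have key : ∀ x : ℝ, 1 ≤ x → 0 ≤ x * (x ^ 2 - 1) := fun x hx =>
      mul_nonneg (by linarith) (by nlinarith)
    have key2 : ∀ x : ℝ, 2 ≤ x → 0 < x * (x ^ 2 - 1) := fun x hx =>
      mul_pos (by linarith) (by nlinarith)
    rw [hD]
    refine mul_pos (by positivity) ?_
    rcases le_max_iff.mp h2 with h | h
    · exact add_pos_of_nonneg_of_pos (key _ hN1) (key2 _ (by exact_mod_cast h))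
    · exact add_pos_of_pos_of_nonneg (key2 _ (by exact_mod_cast h)) (key _ hM1)
  have hdet : ((Gamma M N)ᵀ * Gamma M N).det = D := by
    rw [gamma_gram_aux, Matrix.det_fin_three, hD]
    simp
    ring
  have hne : ((Gamma M N)ᵀ * Gamma M N) *ᵥ est = (Gamma M N)ᵀ *ᵥ Λ := by
    rw [hest, Matrix.mulVec_mulVec, Matrix.mul_nonsing_inv _ (by
      rw [hdet]; exact isUnit_iff_ne_zero.mpr hDpos.ne'), Matrix.one_mulVec]
  obtain ⟨l0, l1, l2⟩ := gamma_mulVec_aux M N (fun n => α + (n : ℝ) * μ + e n)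
    (fun n => γ + (n : ℝ) * μ + f n) Λ hΛ
  rw [gamma_gram_aux] at hne
  have r0 := congrFun hne 0
  have r1 := congrFun hne 1
  have r2 := congrFun hne 2
  simp only [Matrix.mulVec, dotProduct, Matrix.transpose_apply] at r0 r1 r2
  rw [l0] at r0
  rw [l1] at r1
  rw [l2] at r2
  simp only [mul_add, Finset.sum_add_distrib, ← mul_assoc, ← Finset.sum_mul, sum_sq_aux,
    sum_id_aux, Finset.sum_const, Nat.card_Icc, Nat.add_sub_cancel, nsmul_eq_mul] at r0 r1 r2
  simp [Fin.sum_univ_three] at r0 r1 r2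
  generalize ∑ n ∈ Finset.Icc 1 N, e n = E at *
  generalize ∑ n ∈ Finset.Icc 1 M, f n = F at *
  generalize ∑ n ∈ Finset.Icc 1 N, (n : ℝ) * e n = E1 at *
  generalize ∑ n ∈ Finset.Icc 1 M, (n : ℝ) * f n = F1 at *
  have hD' := hDpos.ne'
  constructor
  · rw [eq_div_iff hD', hD]
    linear_combination ((M : ℝ) / 12 * (2 * (N : ℝ) * ((N : ℝ) + 1) * (2 * (N : ℝ) + 1) +
            (M : ℝ) * ((M : ℝ) ^ 2 - 1))) * r0 +
      ((M : ℝ) * N * ((M : ℝ) + 1) * ((N : ℝ) + 1) / 4) * r1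
        - ((M : ℝ) * N * ((N : ℝ) + 1) / 2) * r2
  · rw [eq_div_iff hD', hD]
    linear_combination (-((M : ℝ) * N * ((N : ℝ) + 1) / 2)) * r0
        - ((N : ℝ) * M * ((M : ℝ) + 1) / 2) * r1 + ((M : ℝ) * N) * r2
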